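/- Let 0 = p_0 < p_1 < … < p_m = n and let s : [n] → [m] be the monotone surjection with s(j) = r whenever p_{r−1} < j ≤ p_r. Let d be a decoration of [m]. Then the map Γ ↦ s^{-1}(Γ) is an order isomorphism (a bijection preserving the refinement order in both directions) from P^{d,ε}_m onto the interval [0̃_m, 1̂_n] inside P^{d∘s,ε}_n, where 0̃_m := s^{-1}(0̂_m) is the partition of [n] whose blocks are the fibers of s, and 1̂_n is the one-block partition of [n]. In particular, a (d∘s)-decorated ε-noncrossing partition Φ of [n] satisfies Φ ≥ 0̃_m if and only if Φ = s^{-1}(Γ) for some d-decorated ε-noncrossing partition Γ of [m]. -/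

import Mathlib

/-!
Common setup: ε-noncrossing partitions (Ebrahimi-Fard–Patras–Speicher).

A partition of `[n]` is encoded as a `Setoid (Fin n)` (blocks = equivalence
classes).  A decoration is a map `d : Fin n → I`, and `ε : I → I → Bool` is a
symmetric family of values in `{0,1}` (with `true` playing the role of `1`).
-/

namespace EpsNC

open scoped Classical

variable {I : Type*}

/-- The partition `σ(Γ)`: blocks are the images under `σ` of the blocks of `Γ`. -/
def permSetoid {n : ℕ} (σ : Equiv.Perm (Fin n)) (Γ : Setoid (Fin n)) : Setoid (Fin n) :=
  Setoid.comap (⇑σ⁻¹) Γ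

/-- The decoration `σ(d)`, `σ(d)(i) = d(σ⁻¹(i))`. -/
def permDec {n : ℕ} (σ : Equiv.Perm (Fin n)) (d : Fin n → I) : Fin n → I :=
  d ∘ ⇑σ⁻¹

/-- The adjacent transposition `(i, j)` with `j = i + 1` is an allowed move for the
`d`-decorated partition `Γ` if `ε_{d(i)d(j)} = 1` and either `d(i) ≠ d(j)`, or
`d(i) = d(j)` and `i`, `j` lie in different blocks of `Γ`. -/
def IsAllowedMove {n : ℕ} (ε : I → I → Bool) (d : Fin n → I) (Γ : Setoid (Fin n))
    (i j : Fin n) : Prop :=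
  (i : ℕ) + 1 = (j : ℕ) ∧ ε (d i) (d j) = true ∧ (d i ≠ d j ∨ ¬ Γ i j)

/-- `σ` is an allowed permutation of the `d`-decorated partition `Γ` if it is a product
`τ_{i_k} ⋯ τ_{i_1}` of adjacent transpositions, each being an allowed move for the
(decorated) partition obtained by applying the previous ones. -/
inductive AllowedPerm {n : ℕ} (ε : I → I → Bool) (d : Fin n → I) (Γ : Setoid (Fin n)) :
    Equiv.Perm (Fin n) → Prop
  | one : AllowedPerm ε d Γ 1
  | step {σ : Equiv.Perm (Fin n)} (i j : Fin n) :
      AllowedPerm ε d Γ σ →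
      IsAllowedMove ε (permDec σ d) (permSetoid σ Γ) i j →
      AllowedPerm ε d Γ (Equiv.swap i j * σ)

/-- Standardization of the restriction of a map on `Fin n` to a subset `S`,
via the unique order isomorphism `Fin S.card ≃o S`. -/
noncomputable def restrictFun {n : ℕ} {α : Type*} (f : Fin n → α) (S : Finset (Fin n)) :
    Fin S.card → α :=
  fun k => f (S.orderIsoOfFin rfl k).1

/-- Standardization of the restriction of a partition of `Fin n` to a subset `S`,
via the unique order isomorphism `Fin S.card ≃o S` (blocks are the nonempty
intersections of blocks with `S`, transported to `Fin S.card`). -/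
noncomputable def restrictSetoid {n : ℕ} (Γ : Setoid (Fin n)) (S : Finset (Fin n)) :
    Setoid (Fin S.card) :=
  Setoid.comap (fun k => (S.orderIsoOfFin rfl k).1) Γ

/-- The block of the partition `Γ` containing `b`. -/
noncomputable def blockOf {n : ℕ} (Γ : Setoid (Fin n)) (b : Fin n) : Finset (Fin n) :=
  Finset.univ.filter (fun x => Γ b x)

/-- A subset of `Fin n` is an interval of consecutive integers iff it is order-connected. -/
def IsIntervalBlock {n : ℕ} (S : Finset (Fin n)) : Prop :=
  ∀ ⦃x y z : Fin n⦄, x ∈ S → z ∈ S → x ≤ y → y ≤ z → y ∈ S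

/-- A `d`-decorated partition `Γ` of `[n]` is ε-noncrossing if it can be reduced to the
empty partition by a finite sequence of reductions: a reduction consists of an allowed
permutation `σ` of `Γ` together with a block of `σ(Γ)` which is an interval of
consecutive integers; it deletes that block and standardizes the result. -/
inductive IsEpsNC (ε : I → I → Bool) : {n : ℕ} → (Fin n → I) → Setoid (Fin n) → Prop
  | empty (d : Fin 0 → I) (Γ : Setoid (Fin 0)) : IsEpsNC ε d Γ
  | reduce {n : ℕ} {d : Fin n → I} {Γ : Setoid (Fin n)}
      (σ : Equiv.Perm (Fin n)) (b : Fin n)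
      (hσ : AllowedPerm ε d Γ σ)
      (hint : IsIntervalBlock (blockOf (permSetoid σ Γ) b))
      (hrec : IsEpsNC ε
        (restrictFun (permDec σ d) (blockOf (permSetoid σ Γ) b)ᶜ)
        (restrictSetoid (permSetoid σ Γ) (blockOf (permSetoid σ Γ) b)ᶜ)) :
      IsEpsNC ε d Γ

/-- A partition of `[n]` is noncrossing if there are no `i < j < k < l` with `i, k` in
one block and `j, l` in a different block. -/
def IsNoncrossing {n : ℕ} (Γ : Setoid (Fin n)) : Prop :=
  ∀ ⦃i j k l : Fin n⦄, i < j → j < k → k < l → Γ i k → Γ j l → Γ i j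

/-- The set of blocks of a partition, as finsets. -/
noncomputable def blocksSet {n : ℕ} (Γ : Setoid (Fin n)) : Set (Finset (Fin n)) :=
  {B | ∃ b : Fin n, B = blockOf Γ b}

/-- `k_ε^Γ(a₁, …, aₙ)`: the product over the blocks `Γ_j = {x₁ < … < x_m}` of `Γ` of the
cumulants `κ(a_{x₁}, …, a_{x_m})` (with the corresponding decorations). -/
noncomputable def cumPart {K A : Type*} [Field K] {n : ℕ}
    (κ : (m : ℕ) → (Fin m → I) → (Fin m → A) → K)
    (d : Fin n → I) (Γ : Setoid (Fin n)) (a : Fin n → A) : K :=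
  ∏ᶠ B ∈ blocksSet Γ, κ B.card (restrictFun d B) (restrictFun a B)

/-- `φ^Γ(a₁, …, aₙ)`: the product over the blocks `Γ_j = {x₁ < … < x_m}` of `Γ` of the
moments `φ(a_{x₁} ⋯ a_{x_m})`. -/
noncomputable def phiPart {K A : Type*} [Field K] [Ring A] [Algebra K A] {n : ℕ}
    (φ : A →ₗ[K] K) (Γ : Setoid (Fin n)) (a : Fin n → A) : K :=
  ∏ᶠ B ∈ blocksSet Γ, φ (List.ofFn (restrictFun a B)).prod

/-- The set of setoids on a finite type is finite (needed so that the sums over sets of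
ε-noncrossing partitions below, taken with `∑ᶠ`, are honest finite sums). -/
instance {n : ℕ} : Finite (Setoid (Fin n)) :=
  Finite.of_injective (fun Γ : Setoid (Fin n) => ⇑Γ)
    (fun _ _ h => Setoid.ext fun x y => iff_of_eq (congrFun (congrFun h x) y))

/-- `κ` is the family of ε-cumulants of the noncommutative probability space `(A, φ)`
with distinguished subalgebras `(As i)_{i ∈ I}`: for every `n`, every decoration
`d : Fin n → I` and every tuple `a` with `a j ∈ As (d j)`, the moment-cumulant relation
`φ(a₁ ⋯ aₙ) = Σ_{Γ ∈ P^{d,ε}_n} k_ε^Γ(a)` holds.  (This relation determines `κ`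
uniquely on such tuples.) -/
def CumulantFamily {K A : Type*} [Field K] [Ring A] [Algebra K A]
    (ε : I → I → Bool) (φ : A →ₗ[K] K) (As : I → Subalgebra K A)
    (κ : (m : ℕ) → (Fin m → I) → (Fin m → A) → K) : Prop :=
  ∀ (m : ℕ) (d : Fin m → I) (a : Fin m → A), (∀ j, a j ∈ As (d j)) →
    φ (List.ofFn a).prod = ∑ᶠ Γ ∈ {Γ : Setoid (Fin m) | IsEpsNC ε d Γ}, cumPart κ d Γ a

/-- The tuple `d = (d 1, …, d n)` lies in `I_n^ε`: whenever `d k = d l` for `k < l`,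
there is `k < p < l` with `d p ≠ d k` and `ε_{d(p)d(k)} = 0`. -/
def MemIeps {n : ℕ} (ε : I → I → Bool) (d : Fin n → I) : Prop :=
  ∀ k l : Fin n, k < l → d k = d l →
    ∃ p : Fin n, k < p ∧ p < l ∧ d p ≠ d k ∧ ε (d p) (d k) = false

/-- The subalgebras `(As i)_{i ∈ I}` are ε-independent in `(A, φ)`. -/
def EpsIndependent {K A : Type*} [Field K] [Ring A] [Algebra K A]
    (ε : I → I → Bool) (φ : A →ₗ[K] K) (As : I → Subalgebra K A) : Prop :=
  (∀ i j : I, i ≠ j → ε i j = true →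
    ∀ a ∈ As i, ∀ b ∈ As j, a * b = b * a) ∧
  (∀ (n : ℕ) (d : Fin n → I) (a : Fin n → A), MemIeps ε d →
    (∀ k, a k ∈ As (d k)) → (∀ k, φ (a k) = 0) → φ (List.ofFn a).prod = 0)

/-- The join of two partitions in the lattice `P^{d,ε}_n` of ε-noncrossing partitions:
the finest ε-noncrossing partition coarser than both (computed as the meet, in the full
partition lattice, of all ε-noncrossing upper bounds). -/
noncomputable def epsJoin {n : ℕ} (ε : I → I → Bool) (d : Fin n → I)
    (Φ Ψ : Setoid (Fin n)) : Setoid (Fin n) :=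
  sInf {Θ : Setoid (Fin n) | IsEpsNC ε d Θ ∧ Φ ≤ Θ ∧ Ψ ≤ Θ}

lemma permSetoid_rel {n : ℕ} (σ : Equiv.Perm (Fin n)) (Γ : Setoid (Fin n)) (x y : Fin n) :
    permSetoid σ Γ x y ↔ Γ (σ⁻¹ x) (σ⁻¹ y) :=
  Iff.rfl

lemma restrictSetoid_rel {n : ℕ} (Γ : Setoid (Fin n)) (S : Finset (Fin n)) (x y : Fin S.card) :
    restrictSetoid Γ S x y ↔ Γ (S.orderIsoOfFin rfl x).1 (S.orderIsoOfFin rfl y).1 :=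
  Iff.rfl

lemma permDec_mul {n : ℕ} (τ ρ : Equiv.Perm (Fin n)) (d : Fin n → I) :
    permDec (τ * ρ) d = permDec τ (permDec ρ d) := by
  ext x
  simp [permDec]

lemma permSetoid_mul {n : ℕ} (τ ρ : Equiv.Perm (Fin n)) (Γ : Setoid (Fin n)) :
    permSetoid (τ * ρ) Γ = permSetoid τ (permSetoid ρ Γ) := by
  ext x y
  simp [permSetoid_rel]

/-- Allowed permutations compose. -/
lemma AllowedPerm.mul {n : ℕ} {ε : I → I → Bool} {d : Fin n → I} {Γ : Setoid (Fin n)}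
    {τ ρ : Equiv.Perm (Fin n)} (hρ : AllowedPerm ε d Γ ρ)
    (hτ : AllowedPerm ε (permDec ρ d) (permSetoid ρ Γ) τ) : AllowedPerm ε d Γ (τ * ρ) := by
  induction hτ with
  | one => simpa using hρ
  | step i j _ hmove ih =>
    rw [mul_assoc]
    refine .step i j ih ?_
    rwa [permDec_mul, permSetoid_mul]

/-- A partition is ε-noncrossing as soon as its image under an allowed permutation is. -/
lemma IsEpsNC.of_allowedPerm {n : ℕ} {ε : I → I → Bool} {d : Fin n → I} {Γ : Setoid (Fin n)}
    {ρ : Equiv.Perm (Fin n)} (hρ : AllowedPerm ε d Γ ρ)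
    (h : IsEpsNC ε (permDec ρ d) (permSetoid ρ Γ)) : IsEpsNC ε d Γ := by
  generalize hd : permDec ρ d = d' at h
  generalize hΓ : permSetoid ρ Γ = Γ' at h
  cases h with
  | empty => exact .empty _ _
  | reduce τ b hτ hint hrec =>
    subst hd hΓ
    rw [← permSetoid_mul] at hint
    rw [← permSetoid_mul, ← permDec_mul] at hrec
    exact .reduce (τ * ρ) b (hρ.mul hτ) hint hrec

lemma swap_lt_swap_of_succ {n : ℕ} {i j x y : Fin n} (hij : (i : ℕ) + 1 = j) (hxy : x < y)
    (hne : ¬ (x = i ∧ y = j)) : Equiv.swap i j x < Equiv.swap i j y := by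
  simp only [Equiv.swap_apply_def]
  split_ifs <;> grind

/-- The pairs inverted by an allowed permutation are pairs which may be exchanged. -/
lemma AllowedPerm.of_inversion {n : ℕ} {ε : I → I → Bool} {d : Fin n → I} {Γ : Setoid (Fin n)}
    {σ : Equiv.Perm (Fin n)} (hσ : AllowedPerm ε d Γ σ) {x y : Fin n} (hxy : x < y)
    (hinv : σ y < σ x) : ε (d x) (d y) = true ∧ (d x ≠ d y ∨ ¬ Γ x y) := by
  induction hσ with
  | one => exact absurd hinv hxy.not_gt
  | @step σ i j _ hmove ih =>
    rcases lt_trichotomy (σ y) (σ x) with h | h | h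
    · exact ih h
    · exact absurd (σ.injective h) hxy.ne'
    · by_cases hc : σ x = i ∧ σ y = j
      · obtain ⟨rfl, rfl⟩ := hc
        simpa [IsAllowedMove, permDec, permSetoid_rel] using hmove.2
      · exact absurd hinv (swap_lt_swap_of_succ hmove.1 h hc).not_gt

/-- A permutation all of whose inversions are exchangeable pairs is allowed. -/
lemma allowedPerm_of_inversions {n : ℕ} {ε : I → I → Bool} {d : Fin n → I}
    {Γ : Setoid (Fin n)} (σ : Equiv.Perm (Fin n))
    (hσ : ∀ x y, x < y → σ y < σ x → ε (d x) (d y) = true ∧ (d x ≠ d y ∨ ¬ Γ x y)) :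
    AllowedPerm ε d Γ σ := by
  induction hN : (Finset.univ.filter fun p : Fin n × Fin n => p.1 < p.2 ∧ σ p.2 < σ p.1).card
    using Nat.strong_induction_on generalizing σ with
  | _ N ih =>
  subst hN
  by_cases hdesc : ∃ i j : Fin n, (i : ℕ) + 1 = j ∧ σ⁻¹ j < σ⁻¹ i
  · obtain ⟨i, j, hij, hlt⟩ := hdesc
    have hinv : ∀ x y, x < y → (Equiv.swap i j * σ) y < (Equiv.swap i j * σ) x → σ y < σ x := by
      intro x y hxy h
      rcases lt_trichotomy (σ y) (σ x) with h' | h' | h'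
      · exact h'
      · exact absurd (σ.injective h') hxy.ne'
      · by_cases hc : σ x = i ∧ σ y = j
        · obtain ⟨rfl, rfl⟩ := hc
          simp only [Equiv.Perm.coe_inv, Equiv.symm_apply_apply] at hlt
          exact absurd hlt hxy.not_gt
        · exact absurd h (swap_lt_swap_of_succ hij h' hc).not_gt
    have hlt_ij : i < j := by omega
    have key : AllowedPerm ε d Γ (Equiv.swap i j * σ) := by
      refine ih _ (Finset.card_lt_card ?_) _ (fun x y hxy h => hσ x y hxy (hinv x y hxy h)) rfl
      refine (Finset.ssubset_iff_of_subset ?_).2 ⟨(σ⁻¹ j, σ⁻¹ i), ?_, ?_⟩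
      · intro p hp
        simp only [Finset.mem_filter, Finset.mem_univ, true_and] at hp ⊢
        exact ⟨hp.1, hinv _ _ hp.1 hp.2⟩
      · simp only [Finset.mem_filter, Finset.mem_univ, true_and, Equiv.Perm.coe_inv, Equiv.apply_symm_apply]
        exact ⟨hlt, hlt_ij⟩
      · intro h
        have hinv_swap := (Finset.mem_filter.1 h).2.2
        simp only [Equiv.Perm.mul_apply, Equiv.Perm.coe_inv, Equiv.apply_symm_apply,
          Equiv.swap_apply_left, Equiv.swap_apply_right] at hinv_swap
        exact hinv_swap.not_gt hlt_ij
    have hstep := key.step i j ⟨hij, ?_⟩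
    · rwa [← mul_assoc, Equiv.swap_mul_self, one_mul] at hstep
    · have := hσ _ _ hlt (by simp only [Equiv.Perm.coe_inv, Equiv.apply_symm_apply]; exact hlt_ij)
      simpa [permDec, permSetoid_rel] using this
  · push Not at hdesc
    have hmono : Monotone (⇑σ⁻¹) := by
      cases n with
      | zero => exact fun x => x.elim0
      | succ n => exact Fin.monotone_iff_le_succ.2 fun i => hdesc _ _ (by simp)
    have hone : σ⁻¹ = 1 := by
      have := (Tuple.eq_sort_iff (f := id) (σ := σ⁻¹)).2
        ⟨hmono, fun i j hij h => absurd (σ⁻¹.injective h) hij.ne⟩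
      rw [this, Tuple.sort_eq_refl_iff_monotone.2 monotone_id]
      rfl
    rw [inv_eq_one.1 hone]
    exact .one

/-- A monotone map into `Fin m` with values in `S` factors monotonically through the
standardization of `S`. -/
lemma exists_monotone_orderIsoOfFin_eq {k m : ℕ} {t : Fin k → Fin m} (ht : Monotone t)
    {S : Finset (Fin m)} (hS : ∀ x, t x ∈ S) :
    ∃ r : Fin k → Fin S.card, Monotone r ∧ ∀ x, (S.orderIsoOfFin rfl (r x)).1 = t x :=
  ⟨fun x => (S.orderIsoOfFin rfl).symm ⟨t x, hS x⟩,
    fun _ _ hxy => (S.orderIsoOfFin rfl).symm.monotone (ht hxy), fun x => by simp⟩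

/-- An allowed permutation pulls back along a monotone map to an allowed permutation. -/
lemma AllowedPerm.exists_comap {m n : ℕ} {ε : I → I → Bool} {d : Fin m → I}
    {Γ : Setoid (Fin m)} {σ : Equiv.Perm (Fin m)} (hσ : AllowedPerm ε d Γ σ)
    {s : Fin n → Fin m} (hs : Monotone s) :
    ∃ ρ : Equiv.Perm (Fin n), AllowedPerm ε (d ∘ s) (Setoid.comap s Γ) ρ ∧
      Monotone (σ ∘ s ∘ ⇑ρ⁻¹) := by
  obtain ⟨hmono, hstable⟩ :=
    (Tuple.eq_sort_iff (f := σ ∘ s) (σ := Tuple.sort (σ ∘ s))).1 rfl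
  refine ⟨(Tuple.sort (σ ∘ s))⁻¹, allowedPerm_of_inversions _ fun x y hxy h => ?_, ?_⟩
  · have hle := hmono h.le
    have hst := hstable _ _ h
    simp only [Function.comp_apply, Equiv.Perm.coe_inv, Equiv.apply_symm_apply] at hle hst
    have hlt : σ (s y) < σ (s x) := lt_of_le_of_ne hle fun he => (hst he).not_gt hxy
    have hsxy : s x < s y := lt_of_le_of_ne (hs hxy.le) fun he => by simp [he] at hlt
    exact hσ.of_inversion hsxy hlt
  · rw [inv_inv]
    exact hmono

/-- ε-noncrossing partitions are stable under pullback along monotone maps. -/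
lemma IsEpsNC.comap {m : ℕ} {ε : I → I → Bool} {d : Fin m → I} {Γ : Setoid (Fin m)}
    (h : IsEpsNC ε d Γ) {n : ℕ} {s : Fin n → Fin m} (hs : Monotone s) :
    IsEpsNC ε (d ∘ s) (Setoid.comap s Γ) := by
  induction h generalizing n with
  | empty =>
    obtain rfl : n = 0 := by
      by_contra hn
      exact (s ⟨0, Nat.pos_of_ne_zero hn⟩).elim0
    exact .empty _ _
  | @reduce m d Γ σ b hσ hint hrec ih =>
    obtain ⟨ρ, hρ, hmono⟩ := hσ.exists_comap hs
    set t : Fin n → Fin m := σ ∘ s ∘ ⇑ρ⁻¹ with ht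
    have hdec : permDec ρ (d ∘ s) = permDec σ d ∘ t := by
      ext x
      simp [permDec, ht]
    have hrel : ∀ x y, permSetoid ρ (Setoid.comap s Γ) x y ↔ permSetoid σ Γ (t x) (t y) := by
      intro x y
      simp [permSetoid_rel, ht, Setoid.comap_rel]
    by_cases hb : ∃ c, permSetoid σ Γ b (t c)
    · obtain ⟨c, hc⟩ := hb
      have hblock : ∀ x, x ∈ blockOf (permSetoid ρ (Setoid.comap s Γ)) c ↔
          t x ∈ blockOf (permSetoid σ Γ) b := by
        intro x
        simp only [blockOf, Finset.mem_filter, Finset.mem_univ, true_and, hrel]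
        exact ⟨fun h => Setoid.trans' _ hc h, fun h => Setoid.trans' _ (Setoid.symm' _ hc) h⟩
      refine .reduce ρ c hρ (fun x y z hx hz hxy hyz => ?_) ?_
      · rw [hblock] at hx hz ⊢
        exact hint hx hz (hmono hxy) (hmono hyz)
      · set S := (blockOf (permSetoid ρ (Setoid.comap s Γ)) c)ᶜ
        obtain ⟨r, hr, hrt⟩ := exists_monotone_orderIsoOfFin_eq
          (t := fun k => t (S.orderIsoOfFin rfl k).1)
          (S := (blockOf (permSetoid σ Γ) b)ᶜ)
          (fun x y hxy => hmono ((S.orderIsoOfFin rfl).monotone hxy))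
          (fun x => by
            have hx := Finset.mem_compl.1 (S.orderIsoOfFin rfl x).2
            exact Finset.mem_compl.2 ((hblock _).not.1 hx))
        convert ih hr using 1
        · ext x
          simp only [restrictFun, Function.comp_apply, hrt, hdec]
        · ext x y
          simp only [restrictSetoid_rel, Setoid.comap_rel, hrt, hrel]
    · push Not at hb
      obtain ⟨r, hr, hrt⟩ := exists_monotone_orderIsoOfFin_eq hmono
        (S := (blockOf (permSetoid σ Γ) b)ᶜ) (fun x => by simpa [blockOf] using hb x)
      refine .of_allowedPerm hρ ?_
      convert ih hr using 1
      · ext x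
        simp only [restrictFun, Function.comp_apply, hrt, hdec]
      · ext x y
        simp only [restrictSetoid_rel, Setoid.comap_rel, hrt, hrel]

/-- For surjective `s`, pullback of partitions along `s` reflects and preserves refinement. -/
lemma comap_le_comap_iff {α β : Type*} {s : α → β} (hs : Function.Surjective s)
    {Γ Γ' : Setoid β} : Setoid.comap s Γ ≤ Setoid.comap s Γ' ↔ Γ ≤ Γ' := by
  refine ⟨fun h x y hxy => ?_, fun h x y hxy => h hxy⟩
  obtain ⟨x, rfl⟩ := hs x
  obtain ⟨y, rfl⟩ := hs y
  exact h hxy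

/-- Let `s : [n] → [m]` be a monotone surjection (equivalently, the map
determined by `0 = p₀ < p₁ < … < p_m = n` via `s(j) = r` for `p_{r-1} < j ≤ p_r`) and
`d` a decoration of `[m]`.  Then `Γ ↦ s⁻¹(Γ)` is an order isomorphism from `P^{d,ε}_m`
onto the interval `[0̃_m, 1̂_n]` in `P^{d∘s,ε}_n`, where `0̃_m = s⁻¹(0̂_m)` is the
partition of `[n]` into the fibers of `s` (i.e. `Setoid.ker s`).  In particular a
`(d∘s)`-decorated ε-noncrossing partition `Φ` of `[n]` satisfies `Φ ≥ 0̃_m` iff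
`Φ = s⁻¹(Γ)` for some (unique) `Γ ∈ P^{d,ε}_m`. -/
theorem comap_orderIso_interval {I : Type*} (ε : I → I → Bool)
    (hsym : ∀ i j : I, ε i j = ε j i)
    {n m : ℕ} (s : Fin n → Fin m) (hmono : Monotone s) (hsurj : Function.Surjective s)
    (d : Fin m → I) :
    (∀ Γ : Setoid (Fin m), IsEpsNC ε d Γ →
      IsEpsNC ε (d ∘ s) (Setoid.comap s Γ) ∧ Setoid.ker s ≤ Setoid.comap s Γ) ∧
    (∀ Φ : Setoid (Fin n), IsEpsNC ε (d ∘ s) Φ → Setoid.ker s ≤ Φ →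
      ∃! Γ : Setoid (Fin m), IsEpsNC ε d Γ ∧ Setoid.comap s Γ = Φ) ∧
    (∀ Γ Γ' : Setoid (Fin m), IsEpsNC ε d Γ → IsEpsNC ε d Γ' →
      (Γ ≤ Γ' ↔ Setoid.comap s Γ ≤ Setoid.comap s Γ')) := by
  refine ⟨fun Γ hΓ => ⟨hΓ.comap hmono, fun x y hxy => ?_⟩, fun Φ hΦ hker => ?_,
    fun Γ Γ' _ _ => (comap_le_comap_iff hsurj).symm⟩
  · rw [Setoid.ker_def] at hxy
    rw [Setoid.comap_rel, hxy]
  · obtain ⟨t, ht⟩ := hsurj.hasRightInverse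
    have htmono : Monotone t := fun x y hxy => by
      by_contra! hlt
      have hle := hmono hlt.le
      rw [ht, ht] at hle
      exact hlt.ne (congrArg t (le_antisymm hle hxy))
    have hts : ∀ x, Φ (t (s x)) x := fun x => hker (ht (s x))
    have hcomap : Setoid.comap s (Setoid.comap t Φ) = Φ := by
      ext x y
      simp only [Setoid.comap_rel]
      exact ⟨fun h => Φ.trans' (Φ.symm' (hts x)) (Φ.trans' h (hts y)),
        fun h => Φ.trans' (hts x) (Φ.trans' h (Φ.symm' (hts y)))⟩
    refine ⟨Setoid.comap t Φ, ⟨?_, hcomap⟩, fun Γ hΓ => ?_⟩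
    · have hd : (d ∘ s) ∘ t = d := by
        ext x
        simp only [Function.comp_apply, ht x]
      simpa only [hd] using hΦ.comap htmono
    · have he := hΓ.2.trans hcomap.symm
      exact le_antisymm ((comap_le_comap_iff hsurj).1 he.le)
        ((comap_le_comap_iff hsurj).1 he.ge)

end EpsNC
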